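/- (Discrete Hardy–Littlewood–Sobolev) Let d ≥ 1, let 0 < α < d and let 1 < q < p < ∞ satisfy 1 + 1/p = α/d + 1/q. Then there is a constant C(d, α, p) such that for every f : ℤ^d → ℝ with ∑_y |f(y)|^q < ∞: ( ∑_{x∈ℤ^d} ( ∑_{y∈ℤ^d} (|x−y|+1)^{−α} |f(y)| )^p )^{1/p} ≤ C(d,α,p)·( ∑_y |f(y)|^q )^{1/q}. -/

import Mathlib

open Real

/-- The Euclidean norm of a lattice point of `ℤ^d`. -/
noncomputable def znorm {d : ℕ} (x : Fin d → ℤ) : ℝ :=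
  Real.sqrt (∑ i, ((x i : ℝ)) ^ 2)

open Finset in
lemma hls_geom (a b : ℝ) (ha : 0 < a) (hb : 0 < b) : ∃ C : ℝ, 0 ≤ C ∧ ∀ u : ℝ, 0 < u → ∀ S : Finset ℕ,
    ∑ k ∈ S, min (((2:ℝ)^k / u) ^ a) (((2:ℝ)^k / u) ^ (-b)) ≤ C := by
  set c := min a b with hc
  have hc0 : 0 < c := lt_min ha hb
  set ρ : ℝ := (2:ℝ) ^ (-c) with hρ
  have hρ0 : 0 < ρ := by positivity
  have hρ1 : ρ < 1 := Real.rpow_lt_one_of_one_lt_of_neg (by norm_num) (by linarith)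
  have hsum : Summable (fun k : ℤ => ρ ^ k.natAbs) := by
    rw [summable_int_iff_summable_nat_and_neg]
    simp only [Int.natAbs_neg, Int.natAbs_natCast, and_self]
    exact summable_geometric_of_lt_one hρ0.le hρ1
  refine ⟨2 ^ c * ∑' k : ℤ, ρ ^ k.natAbs, ?_, ?_⟩
  · have : 0 ≤ ∑' k : ℤ, ρ ^ k.natAbs := tsum_nonneg fun k => by positivity
    positivity
  intro u hu S
  set t := Real.logb 2 u with ht
  have hut : u = 2 ^ t := (Real.rpow_logb (by norm_num) (by norm_num) hu).symm
  set j := ⌊t⌋ with hj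
  have hterm : ∀ k ∈ S, min (((2:ℝ)^k / u) ^ a) (((2:ℝ)^k / u) ^ (-b)) ≤ 2 ^ c * ρ ^ ((k:ℤ) - j).natAbs := by
    intro k _
    have e1 : (2:ℝ)^k / u = 2 ^ ((k:ℝ) - t) := by
      rw [hut, Real.rpow_sub (by norm_num), Real.rpow_natCast]
    have e2 : (2:ℝ) ^ c * ρ ^ ((k:ℤ) - j).natAbs = 2 ^ (c - c * (((k:ℤ) - j).natAbs : ℝ)) := by
      rw [hρ, ← Real.rpow_natCast, ← Real.rpow_mul (by norm_num), ← Real.rpow_add (by norm_num)]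
      ring_nf
    rw [e1, e2, ← Real.rpow_mul (by norm_num), ← Real.rpow_mul (by norm_num)]
    have h3 : ((((k:ℤ) - j).natAbs : ℕ) : ℝ) = |(k:ℝ) - j| := by
      rw [Nat.cast_natAbs]; push_cast; rfl
    rw [h3]
    have f1 : (j:ℝ) ≤ t := Int.floor_le t
    have f2 : t < j + 1 := Int.lt_floor_add_one t
    have ca : c ≤ a := min_le_left _ _
    have cb : c ≤ b := min_le_right _ _
    rcases le_total (k:ℝ) t with h | h
    · refine (min_le_left _ _).trans (Real.rpow_le_rpow_of_exponent_le (by norm_num) ?_)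
      have : |(k:ℝ) - j| ≤ (t - k) + 1 := by rw [abs_le]; constructor <;> linarith
      nlinarith
    · refine (min_le_right _ _).trans (Real.rpow_le_rpow_of_exponent_le (by norm_num) ?_)
      have : |(k:ℝ) - j| ≤ (k - t) + 1 := by rw [abs_le]; constructor <;> linarith
      nlinarith
  refine (Finset.sum_le_sum hterm).trans ?_
  rw [← Finset.mul_sum]
  refine mul_le_mul_of_nonneg_left ?_ (by positivity)
  have := hsum.sum_le_tsum (S.map ⟨fun k : ℕ => (k:ℤ) - j, fun x y h => by simpa using h⟩)
    (fun k _ => by positivity)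
  rw [Finset.sum_map] at this
  exact this

/-- dyadic scale of a lattice point -/
def hlsScale {d : ℕ} (z : Fin d → ℤ) : ℕ :=
  Nat.log 2 (Finset.univ.sup (fun i => (z i).natAbs) + 1)

lemma hls_znorm_ge {d : ℕ} (z : Fin d → ℤ) : (2:ℝ) ^ hlsScale z ≤ znorm z + 1 := by
  have h1 : 2 ^ hlsScale z ≤ Finset.univ.sup (fun i => (z i).natAbs) + 1 :=
    Nat.pow_log_le_self 2 (by omega)
  have h2 : ((Finset.univ.sup (fun i => (z i).natAbs) : ℕ) : ℝ) ≤ znorm z := by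
    have : Finset.univ.sup (fun i => (z i).natAbs) ≤ ⌊znorm z⌋₊ := by
      refine Finset.sup_le fun i _ => Nat.le_floor ?_
      rw [Nat.cast_natAbs]
      push_cast
      refine Real.le_sqrt_of_sq_le ?_
      rw [sq_abs]
      exact Finset.single_le_sum (f := fun i => ((z i : ℝ)) ^ 2) (fun i _ => sq_nonneg _) (Finset.mem_univ i)
    exact (Nat.cast_le.mpr this).trans (Nat.floor_le (Real.sqrt_nonneg _))
  have h3 : ((2 ^ hlsScale z : ℕ) : ℝ) ≤ ((Finset.univ.sup (fun i => (z i).natAbs) + 1 : ℕ) : ℝ) :=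
    Nat.cast_le.mpr h1
  push_cast at h3
  linarith

lemma hls_znorm_nonneg {d : ℕ} (z : Fin d → ℤ) : 0 ≤ znorm z := Real.sqrt_nonneg _

lemma hls_znorm_comm {d : ℕ} (x y : Fin d → ℤ) : znorm (x - y) = znorm (y - x) := by
  unfold znorm
  congr 1
  refine Finset.sum_congr rfl fun i _ => ?_
  simp only [Pi.sub_apply]; push_cast; ring

lemma hls_card {d : ℕ} (S : Finset (Fin d → ℤ)) (x : Fin d → ℤ) (k : ℕ) :
    ((S.filter (fun y => hlsScale (x - y) = k)).card : ℝ) ≤ 4 ^ d * ((2:ℝ) ^ k) ^ (d:ℝ) := by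
  have hsub : S.filter (fun y => hlsScale (x - y) = k) ⊆
      Fintype.piFinset (fun i => Finset.Icc (x i - (2 ^ (k+1) - 1 : ℤ)) (x i + (2^(k+1) - 1 : ℤ))) := by
    intro y hy
    rw [Finset.mem_filter] at hy
    rw [Fintype.mem_piFinset]
    intro i
    have h1 : Finset.univ.sup (fun i => ((x - y) i).natAbs) + 1 < 2 ^ (k+1) := by
      rw [← hy.2]; exact Nat.lt_pow_succ_log_self (by norm_num) _
    have h2 : ((x - y) i).natAbs ≤ Finset.univ.sup (fun i => ((x - y) i).natAbs) :=
      Finset.le_sup (f := fun i => ((x - y) i).natAbs) (Finset.mem_univ i)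
    have h3 : (((x - y) i).natAbs : ℤ) < 2 ^ (k+1) - 1 := by
      have : ((x - y) i).natAbs + 1 < 2 ^ (k+1) := by omega
      have := (Nat.cast_lt (α := ℤ)).mpr this
      push_cast at this ⊢
      linarith
    rw [Pi.sub_apply] at h3
    rw [Finset.mem_Icc]
    generalize (2:ℤ)^(k+1) = M at *
    omega
  have hc := Finset.card_le_card hsub
  rw [Fintype.card_piFinset] at hc
  have hb : ∀ i ∈ (Finset.univ : Finset (Fin d)), (Finset.Icc (x i - (2 ^ (k+1) - 1 : ℤ)) (x i + (2^(k+1) - 1 : ℤ))).card ≤ 4 * 2 ^ k := by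
    intro i _
    rw [Int.card_Icc]
    have : (2:ℤ)^(k+1) = 2 * ((2^k : ℕ) : ℤ) := by push_cast; ring
    rw [this]
    generalize (2:ℕ)^k = M
    omega
  have hp := Finset.prod_le_pow_card _ _ _ hb
  have := hc.trans hp
  rw [Finset.card_univ, Fintype.card_fin] at this
  have := (Nat.cast_le (α := ℝ)).mpr this
  push_cast at this
  rw [Real.rpow_natCast, ← mul_pow]
  exact this

lemma hls_key (d : ℕ) (hd : 1 ≤ d) (α r : ℝ) (hα0 : 0 < α) (hαd : α < d) (hr : 1 < r)
    (he : 0 < α / d - (1 - 1 / r)) : ∃ C : ℝ, 0 ≤ C ∧ ∀ (S : Finset (Fin d → ℤ)) (h : (Fin d → ℤ) → ℝ)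
      (x : Fin d → ℤ) (l : ℝ), 0 < l → (∀ y, 0 ≤ h y) → (∑ y ∈ S, h y ^ r ≤ 1) →
      (∀ y ∈ S, h y ^ r ≤ l) →
      ∑ y ∈ S, (znorm (x - y) + 1) ^ (-α) * h y ≤ C * l ^ (α / d - (1 - 1 / r)) := by
  have hd0 : (0:ℝ) < d := by exact_mod_cast hd
  set b : ℝ := α - d * (1 - 1 / r) with hb
  have hbe : b = d * (α / d - (1 - 1 / r)) := by rw [hb]; field_simp
  have hb0 : 0 < b := by rw [hbe]; positivity
  have hr0 : 0 < r := by linarith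
  have hr1 : 0 < 1 - 1 / r := by
    have : 1 / r < 1 := by rw [div_lt_one hr0]; exact hr
    linarith
  obtain ⟨C, hC0, hC⟩ := hls_geom (d - α) b (by linarith) hb0
  refine ⟨4 ^ d * C, by positivity, ?_⟩
  intro S h x l hl hh hS hhl
  set u : ℝ := l ^ (-(1 / (d:ℝ))) with hu
  have hu0 : 0 < u := by positivity
  rw [← Finset.sum_fiberwise_of_maps_to (s := S) (t := S.image (fun y => hlsScale (x - y)))
    (g := fun y => hlsScale (x - y)) (fun y hy => Finset.mem_image_of_mem _ hy)]
  have hk : ∀ k ∈ S.image (fun y => hlsScale (x - y)),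
      ∑ y ∈ S with hlsScale (x - y) = k, (znorm (x - y) + 1) ^ (-α) * h y ≤
      4 ^ d * l ^ (α / d - (1 - 1 / r)) * min (((2:ℝ)^k / u) ^ ((d:ℝ) - α)) (((2:ℝ)^k / u) ^ (-b)) := by
    intro k _
    set T := S.filter (fun y => hlsScale (x - y) = k) with hT
    have hcard := hls_card S x k
    rw [← hT] at hcard
    set D : ℝ := (2:ℝ)^k with hD
    have hD0 : 0 < D := by positivity
    have hfirst : ∑ y ∈ T, (znorm (x - y) + 1) ^ (-α) * h y ≤ D ^ (-α) * ∑ y ∈ T, h y := by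
      rw [Finset.mul_sum]
      refine Finset.sum_le_sum fun y hy => mul_le_mul_of_nonneg_right ?_ (hh y)
      have : hlsScale (x - y) = k := (Finset.mem_filter.mp hy).2
      have h2 := hls_znorm_ge (x - y)
      rw [this] at h2
      exact Real.rpow_le_rpow_of_nonpos hD0 h2 (by linarith)
    have hA : ∑ y ∈ T, h y ≤ 4 ^ d * D ^ (d:ℝ) * l ^ (1 / r) := by
      calc ∑ y ∈ T, h y ≤ ∑ y ∈ T, l ^ (1 / r) := by
            refine Finset.sum_le_sum fun y hy => ?_
            have := Real.rpow_le_rpow (by have := hh y; positivity) (hhl y (Finset.mem_filter.mp hy).1)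
              (show 0 ≤ 1 / r by positivity)
            rwa [← Real.rpow_mul (hh y), mul_one_div_cancel hr0.ne', Real.rpow_one] at this
        _ = T.card * l ^ (1 / r) := by rw [Finset.sum_const, nsmul_eq_mul]
        _ ≤ _ := by gcongr
    have hB : ∑ y ∈ T, h y ≤ 4 ^ d * D ^ (d * (1 - 1 / r)) := by
      have hconj : r.HolderConjugate (r / (r - 1)) := Real.HolderConjugate.conjExponent hr
      have hH := Real.inner_le_Lp_mul_Lq_of_nonneg T hconj (f := h) (g := fun _ => 1)
        (fun y _ => hh y) (fun _ _ => zero_le_one)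
      simp only [mul_one, Real.one_rpow, Finset.sum_const, nsmul_eq_mul] at hH
      have e1 : 1 / (r / (r - 1)) = 1 - 1 / r := by
        have : r - 1 ≠ 0 := by linarith
        field_simp
      rw [e1] at hH
      have g1 : (∑ y ∈ T, h y ^ r) ^ (1 / r) ≤ 1 := by
        refine Real.rpow_le_one (Finset.sum_nonneg fun y _ => Real.rpow_nonneg (hh y) _) ?_ (by positivity)
        refine le_trans (Finset.sum_le_sum_of_subset_of_nonneg (Finset.filter_subset _ _) ?_) hS
        exact fun y _ _ => Real.rpow_nonneg (hh y) _
      have g2 : (T.card : ℝ) ^ (1 - 1 / r) ≤ 4 ^ d * D ^ (d * (1 - 1 / r)) := by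
        refine (Real.rpow_le_rpow (by positivity) hcard hr1.le).trans ?_
        rw [Real.mul_rpow (by positivity) (by positivity), ← Real.rpow_mul hD0.le]
        gcongr
        have : (1:ℝ) ≤ 4 ^ d := one_le_pow₀ (by norm_num)
        calc ((4:ℝ)^d) ^ (1 - 1 / r) ≤ ((4:ℝ)^d) ^ (1:ℝ) := by
              apply Real.rpow_le_rpow_of_exponent_le this
              have : 0 < 1 / r := by positivity
              linarith
          _ = _ := Real.rpow_one _
      calc ∑ y ∈ T, h y ≤ _ := hH
        _ ≤ 1 * (T.card : ℝ) ^ (1 - 1 / r) := by gcongr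
        _ ≤ _ := by rw [one_mul]; exact g2
    refine hfirst.trans ?_
    have hul : ∀ s : ℝ, u ^ s = l ^ (-(s / d)) := by
      intro s
      rw [hu, ← Real.rpow_mul hl.le]
      congr 1; ring
    rw [mul_min_of_nonneg _ _ (by positivity), Real.div_rpow hD0.le hu0.le, Real.div_rpow hD0.le hu0.le,
      hul, hul]
    refine le_min ?_ ?_
    · refine (mul_le_mul_of_nonneg_left hA (by positivity)).trans (le_of_eq ?_)
      have e1 : D ^ ((d:ℝ) - α) = D ^ (-α) * D ^ (d:ℝ) := by
        rw [← Real.rpow_add hD0]; ring_nf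
      have e2 : l ^ (1 / r) = l ^ (α / d - (1 - 1 / r)) / l ^ (-((d - α) / d)) := by
        rw [← Real.rpow_sub hl]; congr 1; field_simp; ring
      rw [e1, e2]; ring
    · refine (mul_le_mul_of_nonneg_left hB (by positivity)).trans (le_of_eq ?_)
      have e1 : D ^ (-b) = D ^ (-α) * D ^ (d * (1 - 1 / r)) := by
        rw [← Real.rpow_add hD0, hb]; ring_nf
      have e2 : -(-b / d) = α / d - (1 - 1 / r) := by
        rw [hbe]; field_simp
      rw [e1, e2]
      have : l ^ (α / d - (1 - 1 / r)) ≠ 0 := by positivity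
      field_simp
  refine (Finset.sum_le_sum hk).trans ?_
  rw [← Finset.mul_sum]
  calc _ ≤ 4 ^ d * l ^ (α / d - (1 - 1 / r)) * C := by gcongr; exact hC u hu0 _
    _ = _ := by ring

/-- normalised bilinear form -/
lemma hls_bilin (d : ℕ) (hd : 1 ≤ d)
    (α p q : ℝ) (hα0 : 0 < α) (hαd : α < d) (hq : 1 < q) (hqp : q < p)
    (hrel : 1 + 1 / p = α / d + 1 / q) : ∃ C : ℝ, 0 ≤ C ∧ ∀ (A B : Finset (Fin d → ℤ))
    (h f : (Fin d → ℤ) → ℝ), (∀ x, 0 ≤ h x) → (∀ x, 0 ≤ f x) →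
    (∑ x ∈ A, h x ^ (p / (p - 1)) ≤ 1) → (∑ y ∈ B, f y ^ q ≤ 1) →
    ∑ x ∈ A, h x * ∑ y ∈ B, (znorm (x - y) + 1) ^ (-α) * f y ≤ C := by
  have hp1 : 0 < p - 1 := by linarith
  have hp0 : 0 < p := by linarith
  have hq0 : 0 < q := by linarith
  have hr : 1 < p / (p - 1) := by rw [lt_div_iff₀ hp1]; linarith
  have ep : 1 / (p / (p - 1)) = 1 - 1 / p := by field_simp
  have E1 : α / d - (1 - 1 / q) = 1 / p := by linarith
  have E2 : α / d - (1 - 1 / (p / (p - 1))) = 1 - 1 / q := by rw [ep]; linarith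
  have hq1 : 0 < 1 - 1 / q := by
    have : 1 / q < 1 := by rw [div_lt_one hq0]; exact hq
    linarith
  obtain ⟨C₁, hC₁, H₁⟩ := hls_key d hd α q hα0 hαd hq (by rw [E1]; positivity)
  obtain ⟨C₂, hC₂, H₂⟩ := hls_key d hd α (p / (p - 1)) hα0 hαd hr (by rw [E2]; exact hq1)
  rw [E1] at H₁
  rw [E2] at H₂
  set r := p / (p - 1) with hrdef
  have hr0 : 0 < r := by linarith
  refine ⟨C₁ + C₂, by positivity, ?_⟩
  intro A B h f hh hf hA hB
  have hK : ∀ x y : Fin d → ℤ, 0 ≤ (znorm (x - y) + 1) ^ (-α) := fun x y => by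
    have := hls_znorm_nonneg (x - y); positivity
  have hsplit : ∑ x ∈ A, h x * ∑ y ∈ B, (znorm (x - y) + 1) ^ (-α) * f y =
      ∑ x ∈ A, h x * ∑ y ∈ B with f y ^ q ≤ h x ^ r, (znorm (x - y) + 1) ^ (-α) * f y +
      ∑ y ∈ B, f y * ∑ x ∈ A with ¬ f y ^ q ≤ h x ^ r, (znorm (y - x) + 1) ^ (-α) * h x := by
    have : ∑ y ∈ B, f y * ∑ x ∈ A with ¬ f y ^ q ≤ h x ^ r, (znorm (y - x) + 1) ^ (-α) * h x =
        ∑ x ∈ A, h x * ∑ y ∈ B with ¬ f y ^ q ≤ h x ^ r, (znorm (x - y) + 1) ^ (-α) * f y := by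
      simp only [Finset.mul_sum, Finset.sum_filter]
      rw [Finset.sum_comm]
      refine Finset.sum_congr rfl fun x _ => Finset.sum_congr rfl fun y _ => ?_
      rw [hls_znorm_comm x y]
      split_ifs <;> ring
    rw [this, ← Finset.sum_add_distrib]
    refine Finset.sum_congr rfl fun x _ => ?_
    rw [← mul_add, Finset.sum_filter_add_sum_filter_not]
  rw [hsplit]
  refine add_le_add ?_ ?_
  · calc _ ≤ ∑ x ∈ A, C₁ * h x ^ r := by
          refine Finset.sum_le_sum fun x _ => ?_
          rcases (hh x).eq_or_lt with h0 | h0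
          · rw [← h0, Real.zero_rpow hr0.ne']; simp
          have := H₁ (B.filter (fun y => f y ^ q ≤ h x ^ r)) f x (h x ^ r) (by positivity) hf
            (le_trans (Finset.sum_le_sum_of_subset_of_nonneg (Finset.filter_subset _ _)
              fun y _ _ => Real.rpow_nonneg (hf y) _) hB)
            (fun y hy => (Finset.mem_filter.mp hy).2)
          refine (mul_le_mul_of_nonneg_left this (hh x)).trans (le_of_eq ?_)
          rw [← Real.rpow_mul h0.le]
          have : h x ^ r = h x * h x ^ (r * (1 / p)) := by
            nth_rewrite 2 [← Real.rpow_one (h x)]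
            rw [← Real.rpow_add h0]; congr 1; rw [hrdef]; field_simp; ring
          rw [this]; ring
      _ = C₁ * ∑ x ∈ A, h x ^ r := by rw [Finset.mul_sum]
      _ ≤ C₁ * 1 := by gcongr
      _ = C₁ := mul_one _
  · calc _ ≤ ∑ y ∈ B, C₂ * f y ^ q := by
          refine Finset.sum_le_sum fun y _ => ?_
          rcases (hf y).eq_or_lt with h0 | h0
          · rw [← h0, Real.zero_rpow hq0.ne']; simp
          have := H₂ (A.filter (fun x => ¬ f y ^ q ≤ h x ^ r)) h y (f y ^ q) (by positivity) hh
            (le_trans (Finset.sum_le_sum_of_subset_of_nonneg (Finset.filter_subset _ _)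
              fun y _ _ => Real.rpow_nonneg (hh y) _) hA)
            (fun x hx => (not_le.mp (Finset.mem_filter.mp hx).2).le)
          refine (mul_le_mul_of_nonneg_left this (hf y)).trans (le_of_eq ?_)
          rw [← Real.rpow_mul h0.le]
          have : f y ^ q = f y * f y ^ (q * (1 - 1 / q)) := by
            nth_rewrite 2 [← Real.rpow_one (f y)]
            rw [← Real.rpow_add h0]; congr 1; field_simp; ring
          rw [this]; ring
      _ = C₂ * ∑ y ∈ B, f y ^ q := by rw [Finset.mul_sum]
      _ ≤ C₂ * 1 := by gcongr
      _ = C₂ := mul_one _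

/-- finite operator form -/
lemma hls_fin (d : ℕ) (hd : 1 ≤ d)
    (α p q : ℝ) (hα0 : 0 < α) (hαd : α < d) (hq : 1 < q) (hqp : q < p)
    (hrel : 1 + 1 / p = α / d + 1 / q) : ∃ C : ℝ, 0 ≤ C ∧ ∀ (A B : Finset (Fin d → ℤ))
    (f : (Fin d → ℤ) → ℝ) (F : ℝ), 0 < F → (∀ x, 0 ≤ f x) → (∑ y ∈ B, f y ^ q ≤ F ^ q) →
    ∑ x ∈ A, (∑ y ∈ B, (znorm (x - y) + 1) ^ (-α) * f y) ^ p ≤ (C * F) ^ p := by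
  obtain ⟨C, hC, H⟩ := hls_bilin d hd α p q hα0 hαd hq hqp hrel
  have hp1 : 0 < p - 1 := by linarith
  have hp0 : 0 < p := by linarith
  have hq0 : 0 < q := by linarith
  refine ⟨C, hC, ?_⟩
  intro A B f F hF hf hB
  obtain ⟨g, hg⟩ : ∃ g : (Fin d → ℤ) → ℝ, ∀ x, ∑ y ∈ B, (znorm (x - y) + 1) ^ (-α) * f y = g x :=
    ⟨_, fun x => rfl⟩
  have hg0 : ∀ x, 0 ≤ g x := fun x => by
    rw [← hg]
    refine Finset.sum_nonneg fun y _ => ?_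
    have := hls_znorm_nonneg (x - y)
    have := hf y
    positivity
  simp only [hg]
  obtain ⟨G, hG⟩ : ∃ G : ℝ, G = ∑ x ∈ A, g x ^ p := ⟨_, rfl⟩
  rw [← hG]
  have hG0 : 0 ≤ G := hG ▸ Finset.sum_nonneg fun x _ => Real.rpow_nonneg (hg0 x) _
  rcases hG0.eq_or_lt with h0 | h0
  · rw [← h0]; positivity
  have k1 : ∑ x ∈ A, (g x ^ (p - 1) / G ^ (1 - 1 / p)) ^ (p / (p - 1)) ≤ 1 := by
    have : ∀ x ∈ A, (g x ^ (p - 1) / G ^ (1 - 1 / p)) ^ (p / (p - 1)) = g x ^ p / G := by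
      intro x _
      rw [Real.div_rpow (Real.rpow_nonneg (hg0 x) _) (by positivity), ← Real.rpow_mul (hg0 x),
        ← Real.rpow_mul hG0, show (p - 1) * (p / (p - 1)) = p by field_simp,
        show (1 - 1 / p) * (p / (p - 1)) = 1 by field_simp, Real.rpow_one]
    rw [Finset.sum_congr rfl this, ← Finset.sum_div, ← hG, div_self h0.ne']
  have k2 : ∑ y ∈ B, (f y / F) ^ q ≤ 1 := by
    have : ∀ y ∈ B, (f y / F) ^ q = f y ^ q / F ^ q := fun y _ => Real.div_rpow (hf y) hF.le _
    rw [Finset.sum_congr rfl this, ← Finset.sum_div]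
    exact div_le_one_of_le₀ hB (by positivity)
  have key := H A B (fun x => g x ^ (p - 1) / G ^ (1 - 1 / p)) (fun y => f y / F)
    (fun x => div_nonneg (Real.rpow_nonneg (hg0 x) _) (Real.rpow_nonneg hG0 _))
    (fun y => div_nonneg (hf y) hF.le) k1 k2
  have e : ∑ x ∈ A, g x ^ (p - 1) / G ^ (1 - 1 / p) * ∑ y ∈ B, (znorm (x - y) + 1) ^ (-α) * (f y / F)
      = G ^ (1 / p) / F := by
    have : ∀ x ∈ A, g x ^ (p - 1) / G ^ (1 - 1 / p) * ∑ y ∈ B, (znorm (x - y) + 1) ^ (-α) * (f y / F)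
        = g x ^ p * (1 / (G ^ (1 - 1 / p) * F)) := by
      intro x _
      have e1 : ∑ y ∈ B, (znorm (x - y) + 1) ^ (-α) * (f y / F) = g x / F := by
        rw [← hg, Finset.sum_div]
        exact Finset.sum_congr rfl fun y _ => by ring
      have e2 : g x ^ p = g x ^ (p - 1) * g x := by
        rcases (hg0 x).eq_or_lt with h | h
        · rw [← h, Real.zero_rpow hp0.ne', mul_zero]
        · rw [← Real.rpow_add_one h.ne']; congr 1; ring
      rw [e1, e2]; field_simp
    rw [Finset.sum_congr rfl this, ← Finset.sum_mul, ← hG]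
    have e3 : G = G ^ (1 - 1 / p) * G ^ (1 / p) := by
      rw [← Real.rpow_add h0]; simp
    have : G ^ (1 - 1 / p) ≠ 0 := by positivity
    nth_rewrite 1 [e3]
    field_simp
  rw [e, div_le_iff₀ hF] at key
  have := Real.rpow_le_rpow (by positivity) key hp0.le
  rwa [← Real.rpow_mul hG0, one_div_mul_cancel hp0.ne', Real.rpow_one] at this

/-- Discrete Hardy–Littlewood–Sobolev inequality on the lattice `ℤ^d`. -/
theorem discrete_hardy_littlewood_sobolev (d : ℕ) (hd : 1 ≤ d)
    (α p q : ℝ) (hα0 : 0 < α) (hαd : α < d) (hq : 1 < q) (hqp : q < p)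
    (hrel : 1 + 1 / p = α / d + 1 / q) :
    ∃ C : ℝ, ∀ f : (Fin d → ℤ) → ℝ, Summable (fun y => |f y| ^ q) →
      (∑' x : Fin d → ℤ, (∑' y : Fin d → ℤ, (znorm (x - y) + 1) ^ (-α) * |f y|) ^ p)
          ^ (1 / p)
        ≤ C * (∑' y : Fin d → ℤ, |f y| ^ q) ^ (1 / q) := by
  obtain ⟨C, hC, H⟩ := hls_fin d hd α p q hα0 hαd hq hqp hrel
  have hp0 : 0 < p := by linarith
  have hq0 : 0 < q := by linarith
  refine ⟨C, fun f hf => ?_⟩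
  set F := (∑' y : Fin d → ℤ, |f y| ^ q) ^ (1 / q) with hFdef
  have hnn : ∀ y, 0 ≤ |f y| ^ q := fun y => by positivity
  have hS0 : 0 ≤ ∑' y : Fin d → ℤ, |f y| ^ q := tsum_nonneg hnn
  rcases hS0.eq_or_lt with h0 | h0
  · have hz : ∀ y, |f y| = 0 := by
      intro y
      have h1 := hf.le_tsum y (fun j _ => hnn j)
      rw [← h0] at h1
      have h2 := le_antisymm h1 (hnn y)
      exact ((Real.rpow_eq_zero (abs_nonneg _) hq0.ne').mp h2)
    have hF0 : 0 ≤ F := by positivity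
    simp only [hz, mul_zero, tsum_zero, Real.zero_rpow hp0.ne',
      Real.zero_rpow (one_div_pos.mpr hp0).ne']
    positivity
  have hF0 : 0 < F := by positivity
  have hFq : F ^ q = ∑' y : Fin d → ℤ, |f y| ^ q := by
    rw [hFdef, ← Real.rpow_mul hS0, one_div_mul_cancel hq0.ne', Real.rpow_one]
  have hK : ∀ x y : Fin d → ℤ, 0 ≤ (znorm (x - y) + 1) ^ (-α) * |f y| := fun x y => by
    have := hls_znorm_nonneg (x - y); positivity
  have HB : ∀ A B : Finset (Fin d → ℤ), ∑ x ∈ A, (∑ y ∈ B, (znorm (x - y) + 1) ^ (-α) * |f y|) ^ p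
      ≤ (C * F) ^ p := fun A B =>
    H A B (fun y => |f y|) F hF0 (fun y => abs_nonneg _) (by
      rw [hFq]; exact hf.sum_le_tsum B (fun y _ => hnn y))
  have hsum : ∀ x, Summable fun y => (znorm (x - y) + 1) ^ (-α) * |f y| := by
    intro x
    refine summable_of_sum_le (c := C * F) (hK x) fun B => ?_
    have := HB {x} B
    rw [Finset.sum_singleton] at this
    exact (Real.rpow_le_rpow_iff (Finset.sum_nonneg fun y _ => hK x y) (by positivity) hp0).mp this
  have hA : ∀ A : Finset (Fin d → ℤ), ∑ x ∈ A, (∑' y, (znorm (x - y) + 1) ^ (-α) * |f y|) ^ p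
      ≤ (C * F) ^ p := by
    intro A
    have ht : Filter.Tendsto (fun B : Finset (Fin d → ℤ) =>
        ∑ x ∈ A, (∑ y ∈ B, (znorm (x - y) + 1) ^ (-α) * |f y|) ^ p) Filter.atTop
        (nhds (∑ x ∈ A, (∑' y, (znorm (x - y) + 1) ^ (-α) * |f y|) ^ p)) := by
      refine tendsto_finsetSum A fun x _ => ?_
      exact Filter.Tendsto.rpow_const (hsum x).hasSum (Or.inr hp0.le)
    exact le_of_tendsto' ht (fun B => HB A B)
  have hT : ∑' x, (∑' y, (znorm (x - y) + 1) ^ (-α) * |f y|) ^ p ≤ (C * F) ^ p :=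
    tsum_le_of_sum_le' (by positivity) hA
  have := Real.rpow_le_rpow (tsum_nonneg fun x => Real.rpow_nonneg (tsum_nonneg (hK x)) _) hT
    (one_div_pos.mpr hp0).le
  rwa [← Real.rpow_mul (by positivity), mul_one_div_cancel hp0.ne', Real.rpow_one] at this
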